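/- Consider 0/1 variables f_i, fen_i, fex_i (for i ∈ Fin N) and f_{i,j} (for (i,j) ∈ A) subject to the conservation constraints fen_i + Σ_{j : (j,i) ∈ A} f_{j,i} = f_i = fex_i + Σ_{j : (i,j) ∈ A} f_{i,j} for every i, with linear objective Σ_i C i · f_i + Σ_i Cen i · fen_i + Σ_{(i,j) ∈ A} Ctr (i,j) · f_{i,j} + Σ_i Cex i · fex_i. Then the assignment g(s,o_i) = fen_i, g(o_i,h_i) = f_i, g(h_i,o_j) = f_{i,j}, g(h_i,s) = fex_i defines a bijection between the feasible solutions of this integer program and the feasible integral circulations on G_c, and the objective value of each feasible solution equals the total cost Σ_a c(a) · g(a) of the corresponding circulation. Consequently, the minimum value of the integer program equals the minimum cost of a feasible integral circulation on G_c. -/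

import Mathlib

/-- Vertices of the circulation network: `none` is the dummy vertex `s`,
`some (i, false)` is the pre-node `o_i`, `some (i, true)` is the post-node `h_i`. -/
abbrev CVtx (N : ℕ) := Option (Fin N × Bool)

/-- Arcs of the circulation network `G_c`: `(s, o_i)`, `(o_i, h_i)`, `(h_i, s)` for each
`i`, and the transition arcs `(h_i, o_j)` for `(i, j) ∈ A`. -/
def IsArc {N : ℕ} (A : Finset (Fin N × Fin N)) : CVtx N → CVtx N → Prop
  | none, none => False
  | none, some (_, b) => b = false
  | some (_, b), none => b = true
  | some (i, b), some (j, b') =>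
      (b = false ∧ b' = true ∧ i = j) ∨ (b = true ∧ b' = false ∧ (i, j) ∈ A)

/-- Arc costs of the circulation network: `c(s,o_i) = Cen i`, `c(o_i,h_i) = C i`,
`c(h_i,s) = Cex i`, `c(h_i,o_j) = Ctr (i,j)`; non-arcs get cost `0`. -/
def arcCost {N : ℕ} (C Cen Cex : Fin N → ℝ) (Ctr : Fin N × Fin N → ℝ) :
    CVtx N → CVtx N → ℝ
  | none, none => 0
  | none, some (i, b) => if b then 0 else Cen i
  | some (i, b), none => if b then Cex i else 0
  | some (i, b), some (j, b') =>
      if b then (if b' then 0 else Ctr (i, j))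
      else (if b' then (if i = j then C i else 0) else 0)

/-- A feasible solution of the integer linear program: 0/1 variables
`fu i` (= `f_i`), `fen i`, `fex i`, and `ftr (i,j)` (= `f_{i,j}`, supported on `A`),
subject to the conservation constraints
`fen i + Σ_{j : (j,i) ∈ A} ftr (j,i) = fu i = fex i + Σ_{j : (i,j) ∈ A} ftr (i,j)`. -/
structure ILPSol (N : ℕ) (A : Finset (Fin N × Fin N)) where
  fu : Fin N → ℕ
  fen : Fin N → ℕ
  fex : Fin N → ℕ
  ftr : Fin N × Fin N → ℕ
  fu01 : ∀ i, fu i ≤ 1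
  fen01 : ∀ i, fen i ≤ 1
  fex01 : ∀ i, fex i ≤ 1
  ftr01 : ∀ p, ftr p ≤ 1
  ftrA : ∀ p ∉ A, ftr p = 0
  consIn : ∀ i, fen i + ∑ p ∈ A.filter (fun p => p.2 = i), ftr p = fu i
  consOut : ∀ i, fu i = fex i + ∑ p ∈ A.filter (fun p => p.1 = i), ftr p

/-- The linear objective of the integer program. -/
noncomputable def ILPobj {N : ℕ} {A : Finset (Fin N × Fin N)}
    (C Cen Cex : Fin N → ℝ) (Ctr : Fin N × Fin N → ℝ) (x : ILPSol N A) : ℝ :=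
  (∑ i, C i * x.fu i) + (∑ i, Cen i * x.fen i)
    + (∑ p ∈ A, Ctr p * x.ftr p) + (∑ i, Cex i * x.fex i)

/-- A feasible integral circulation on the circulation network `G_c`:
a `{0,1}`-valued function on arcs (zero off arcs) with flow conservation at every
vertex. -/
structure Circ (N : ℕ) (A : Finset (Fin N × Fin N)) where
  g : CVtx N → CVtx N → ℕ
  g01 : ∀ v w, g v w ≤ 1
  supp : ∀ v w, ¬ IsArc A v w → g v w = 0
  cons : ∀ v, ∑ w, g w v = ∑ w, g v w

/-- The total cost of a circulation: the sum over all arcs of the arc cost times the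
flow value. -/
noncomputable def circCost {N : ℕ} {A : Finset (Fin N × Fin N)}
    (C Cen Cex : Fin N → ℝ) (Ctr : Fin N × Fin N → ℝ) (x : Circ N A) : ℝ :=
  ∑ v, ∑ w, arcCost C Cen Cex Ctr v w * x.g v w

/-- Summing over the arcs of `A` entering `i` is summing over all possible tails, for a
function vanishing off `A`. -/
theorem sum_filter_snd_eq {α : Type*} [Fintype α] [DecidableEq α] {A : Finset (α × α)}
    {f : α × α → ℕ} (hf : ∀ p ∉ A, f p = 0) (i : α) :
    ∑ p ∈ A.filter (fun p => p.2 = i), f p = ∑ j, f (j, i) := by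
  rw [Finset.sum_filter, Finset.sum_subset (Finset.subset_univ A)
    (fun p _ hp => by simp [hf p hp]), Fintype.sum_prod_type]
  simp

/-- Summing over the arcs of `A` leaving `i` is summing over all possible heads, for a
function vanishing off `A`. -/
theorem sum_filter_fst_eq {α : Type*} [Fintype α] [DecidableEq α] {A : Finset (α × α)}
    {f : α × α → ℕ} (hf : ∀ p ∉ A, f p = 0) (i : α) :
    ∑ p ∈ A.filter (fun p => p.1 = i), f p = ∑ j, f (i, j) := by
  rw [Finset.sum_filter, Finset.sum_subset (Finset.subset_univ A)
    (fun p _ hp => by simp [hf p hp]), Fintype.sum_prod_type_right]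
  simp

/-- A sum over the vertices of the network, split by kind of vertex. -/
theorem sum_CVtx {N : ℕ} {M : Type*} [AddCommMonoid M] (F : CVtx N → M) :
    ∑ v, F v = F none + (∑ i, F (some (i, true)) + ∑ i, F (some (i, false))) := by
  rw [Fintype.sum_option, Fintype.sum_prod_type]
  simp [Finset.sum_add_distrib]

namespace ILPSol

variable {N : ℕ} {A : Finset (Fin N × Fin N)}

theorem fen_add_sum (x : ILPSol N A) (i : Fin N) :
    x.fen i + ∑ j, x.ftr (j, i) = x.fu i := by
  rw [← x.consIn, sum_filter_snd_eq x.ftrA]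

theorem fex_add_sum (x : ILPSol N A) (i : Fin N) :
    x.fex i + ∑ j, x.ftr (i, j) = x.fu i := by
  rw [x.consOut, sum_filter_fst_eq x.ftrA]

theorem sum_fen_eq_sum_fex (x : ILPSol N A) : ∑ i, x.fen i = ∑ i, x.fex i := by
  have h : ∑ i, (x.fen i + ∑ j, x.ftr (j, i)) = ∑ i, (x.fex i + ∑ j, x.ftr (i, j)) :=
    Finset.sum_congr rfl fun i _ => by rw [x.fen_add_sum, x.fex_add_sum]
  rw [Finset.sum_add_distrib, Finset.sum_add_distrib,
    Finset.sum_comm (f := fun i j => x.ftr (j, i))] at h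
  exact Nat.add_right_cancel h

/-- The arc function on the circulation network given by a solution of the program. -/
def flow (x : ILPSol N A) : CVtx N → CVtx N → ℕ
  | none, none => 0
  | none, some (i, b) => if b then 0 else x.fen i
  | some (i, b), none => if b then x.fex i else 0
  | some (i, b), some (j, b') =>
      if b then (if b' then 0 else x.ftr (i, j))
      else (if b' then (if i = j then x.fu i else 0) else 0)

theorem flow_le_one (x : ILPSol N A) (v w : CVtx N) : x.flow v w ≤ 1 := by
  rcases v with _ | ⟨i, _ | _⟩ <;> rcases w with _ | ⟨j, _ | _⟩ <;>
    simp [flow, x.fen01, x.fex01, x.ftr01]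
  split_ifs <;> simp [x.fu01]

theorem flow_eq_zero (x : ILPSol N A) (v w : CVtx N) (h : ¬ IsArc A v w) :
    x.flow v w = 0 := by
  rcases v with _ | ⟨i, _ | _⟩ <;> rcases w with _ | ⟨j, _ | _⟩ <;>
    simp_all [flow, IsArc, x.ftrA]

theorem flow_conservation (x : ILPSol N A) (v : CVtx N) :
    ∑ w, x.flow w v = ∑ w, x.flow v w := by
  rw [sum_CVtx, sum_CVtx]
  rcases v with _ | ⟨i, _ | _⟩
  · simp [flow, x.sum_fen_eq_sum_fex]
  · simp [flow, x.fen_add_sum]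
  · simp [flow, x.fex_add_sum]

/-- The circulation given by a solution of the program. -/
def toCirc (x : ILPSol N A) : Circ N A where
  g := x.flow
  g01 := x.flow_le_one
  supp := x.flow_eq_zero
  cons := x.flow_conservation

theorem circCost_toCirc (C Cen Cex : Fin N → ℝ) (Ctr : Fin N × Fin N → ℝ)
    (x : ILPSol N A) : circCost C Cen Cex Ctr x.toCirc = ILPobj C Cen Cex Ctr x := by
  have h : ∑ p ∈ A, Ctr p * (x.ftr p : ℝ) = ∑ i, ∑ j, Ctr (i, j) * (x.ftr (i, j) : ℝ) := by
    rw [Finset.sum_subset (Finset.subset_univ A) (fun p _ hp => by simp [x.ftrA p hp]),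
      Fintype.sum_prod_type]
  simp only [circCost, ILPobj, h, sum_CVtx, toCirc, flow, arcCost]
  simp [Finset.sum_add_distrib]
  ring

end ILPSol

namespace Circ

variable {N : ℕ} {A : Finset (Fin N × Fin N)}

theorem inflow_pre (y : Circ N A) (i : Fin N) :
    y.g none (some (i, false)) + ∑ j, y.g (some (j, true)) (some (i, false)) =
      y.g (some (i, false)) (some (i, true)) := by
  have h := y.cons (some (i, false))
  rw [sum_CVtx, sum_CVtx, y.supp (some (i, false)) none (by simp [IsArc]),
    Finset.sum_eq_zero fun j _ => y.supp (some (j, false)) (some (i, false)) (by simp [IsArc]),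
    Finset.sum_eq_zero fun j _ => y.supp (some (i, false)) (some (j, false)) (by simp [IsArc]),
    Finset.sum_eq_single i
      (fun j _ hj => y.supp (some (i, false)) (some (j, true)) (by simp [IsArc, hj.symm]))
      (by simp)] at h
  simpa using h

theorem outflow_post (y : Circ N A) (i : Fin N) :
    y.g (some (i, false)) (some (i, true)) =
      y.g (some (i, true)) none + ∑ j, y.g (some (i, true)) (some (j, false)) := by
  have h := y.cons (some (i, true))
  rw [sum_CVtx, sum_CVtx, y.supp none (some (i, true)) (by simp [IsArc]),
    Finset.sum_eq_zero fun j _ => y.supp (some (j, true)) (some (i, true)) (by simp [IsArc]),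
    Finset.sum_eq_zero fun j _ => y.supp (some (i, true)) (some (j, true)) (by simp [IsArc]),
    Finset.sum_eq_single i
      (fun j _ hj => y.supp (some (j, false)) (some (i, true)) (by simp [IsArc, hj]))
      (by simp)] at h
  simpa using h

theorem g_transition_eq_zero (y : Circ N A) (p : Fin N × Fin N) (hp : p ∉ A) :
    y.g (some (p.1, true)) (some (p.2, false)) = 0 :=
  y.supp _ _ (by simp [IsArc, hp])

/-- The solution of the program given by a circulation. -/
def toILPSol (y : Circ N A) : ILPSol N A where
  fu i := y.g (some (i, false)) (some (i, true))
  fen i := y.g none (some (i, false))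
  fex i := y.g (some (i, true)) none
  ftr p := y.g (some (p.1, true)) (some (p.2, false))
  fu01 _ := y.g01 _ _
  fen01 _ := y.g01 _ _
  fex01 _ := y.g01 _ _
  ftr01 _ := y.g01 _ _
  ftrA := y.g_transition_eq_zero
  consIn i := by rw [sum_filter_snd_eq y.g_transition_eq_zero]; exact y.inflow_pre i
  consOut i := by rw [sum_filter_fst_eq y.g_transition_eq_zero]; exact y.outflow_post i

theorem flow_toILPSol (y : Circ N A) : y.toILPSol.flow = y.g := by
  funext v w
  by_cases h : IsArc A v w
  · rcases v with _ | ⟨i, _ | _⟩ <;> rcases w with _ | ⟨j, _ | _⟩ <;>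
      simp_all [IsArc, ILPSol.flow, toILPSol]
  · rw [y.supp v w h, y.toILPSol.flow_eq_zero v w h]

end Circ

/-- Solutions of the integer program correspond to circulations on the network. -/
def ILPSol.equivCirc (N : ℕ) (A : Finset (Fin N × Fin N)) : ILPSol N A ≃ Circ N A where
  toFun := ILPSol.toCirc
  invFun := Circ.toILPSol
  left_inv x := by simp [Circ.toILPSol, ILPSol.toCirc, ILPSol.flow]
  right_inv y := by
    obtain ⟨g, h1, h2, h3⟩ := y
    simpa only [ILPSol.toCirc, Circ.mk.injEq] using Circ.flow_toILPSol ⟨g, h1, h2, h3⟩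

/-- The assignment `g(s,o_i) = fen_i`, `g(o_i,h_i) = f_i`, `g(h_i,o_j) = f_{i,j}`,
`g(h_i,s) = fex_i` is a bijection between feasible ILP solutions and feasible integral
circulations on `G_c`, and it preserves the objective value. Consequently, the minimum
value of the integer program equals the minimum cost of a feasible integral
circulation. -/
theorem ilp_equiv_min_cost_circulation
    (N : ℕ) (A : Finset (Fin N × Fin N))
    (C Cen Cex : Fin N → ℝ) (Ctr : Fin N × Fin N → ℝ) :
    (∃ Φ : ILPSol N A ≃ Circ N A,
      (∀ x : ILPSol N A, ∀ i, (Φ x).g none (some (i, false)) = x.fen i) ∧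
      (∀ x : ILPSol N A, ∀ i, (Φ x).g (some (i, false)) (some (i, true)) = x.fu i) ∧
      (∀ x : ILPSol N A, ∀ p ∈ A,
        (Φ x).g (some (p.1, true)) (some (p.2, false)) = x.ftr p) ∧
      (∀ x : ILPSol N A, ∀ i, (Φ x).g (some (i, true)) none = x.fex i) ∧
      (∀ x : ILPSol N A, circCost C Cen Cex Ctr (Φ x) = ILPobj C Cen Cex Ctr x)) ∧
    sInf {r | ∃ x : ILPSol N A, ILPobj C Cen Cex Ctr x = r}
      = sInf {r | ∃ y : Circ N A, circCost C Cen Cex Ctr y = r} := by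
  have hcost := ILPSol.circCost_toCirc (A := A) C Cen Cex Ctr
  refine ⟨⟨ILPSol.equivCirc N A, fun x i => by simp [ILPSol.equivCirc, ILPSol.toCirc, ILPSol.flow],
    fun x i => by simp [ILPSol.equivCirc, ILPSol.toCirc, ILPSol.flow],
    fun x p _ => by simp [ILPSol.equivCirc, ILPSol.toCirc, ILPSol.flow],
    fun x i => by simp [ILPSol.equivCirc, ILPSol.toCirc, ILPSol.flow], hcost⟩, ?_⟩
  congr 1
  ext r
  exact (ILPSol.equivCirc N A).exists_congr fun x => by rw [← hcost x]; rfl
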